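/- arXiv:math/0702446 — 2 statements merged into one kernel-verified Lean document; each statement's English description precedes it below -/
import Mathlib

section
/- The backward orbit of 0 under ψ is dense in ℝ: the set of all real x such that for some n ≥ 0 the iterate ψ^{∘n}(x) is defined (i.e. x, ψ(x), …, ψ^{∘(n−1)}(x) are all nonzero) and ψ^{∘n}(x) = 0, is dense in ℝ. -/
/-- The rational function `ψ(x) = x - 1/x`. -/
noncomputable def psi (x : ℝ) : ℝ := x - 1 / x

/-- The backward orbit of `0` under `psi`. -/
def psiBackwardOrbit : Set ℝ := {x : ℝ | ∃ n : ℕ, (∀ k < n, psi^[k] x ≠ 0) ∧ psi^[n] x = 0}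

theorem zero_mem_psiBackwardOrbit : (0 : ℝ) ∈ psiBackwardOrbit := ⟨0, by simp, rfl⟩

theorem mem_psiBackwardOrbit_of_psi_mem {x : ℝ} (hx : x ≠ 0) (h : psi x ∈ psiBackwardOrbit) :
    x ∈ psiBackwardOrbit := by
  obtain ⟨n, hn, h0⟩ := h
  refine ⟨n + 1, fun k hk => ?_, h0⟩
  cases k with
  | zero => exact hx
  | succ k => exact hn k (by omega)

theorem one_mem_psiBackwardOrbit : (1 : ℝ) ∈ psiBackwardOrbit := by
  apply mem_psiBackwardOrbit_of_psi_mem one_ne_zero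
  simpa [psi] using zero_mem_psiBackwardOrbit

theorem neg_mem_psiBackwardOrbit {x : ℝ} (h : x ∈ psiBackwardOrbit) :
    -x ∈ psiBackwardOrbit := by
  have odd : Function.Semiconj (fun y : ℝ => -y) psi psi := fun y => by
    simp only [psi, div_neg]; ring
  have iter (n : ℕ) : psi^[n] (-x) = -psi^[n] x := ((odd.iterate_right n) x).symm
  obtain ⟨n, hn, h0⟩ := h
  exact ⟨n, fun k hk => by simpa [iter] using hn k hk, by simp [iter, h0]⟩

/-- A nondegenerate compact interval `[a, b]` that misses the backward orbit of `0`. -/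
structure IsPsiGap (a b : ℝ) : Prop where
  lt : a < b
  notMem : ∀ x ∈ Set.Icc a b, x ∉ psiBackwardOrbit

namespace IsPsiGap

variable {a b : ℝ}

theorem neg (h : IsPsiGap a b) : IsPsiGap (-b) (-a) where
  lt := neg_lt_neg h.lt
  notMem x hx hS :=
    h.notMem (-x) ⟨by linarith [hx.2], by linarith [hx.1]⟩ (neg_mem_psiBackwardOrbit hS)

theorem pos_or_neg (h : IsPsiGap a b) : 0 < a ∨ b < 0 := by
  by_contra! h0
  exact h.notMem 0 h0 zero_mem_psiBackwardOrbit

theorem mul_pos (h : IsPsiGap a b) : 0 < a * b := by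
  rcases h.pos_or_neg with h0 | h0
  · exact _root_.mul_pos h0 (h0.trans h.lt)
  · exact mul_pos_of_neg_of_neg (h.lt.trans h0) h0

theorem psi_sub_psi (h : IsPsiGap a b) : psi b - psi a = (b - a) * (1 + 1 / (a * b)) := by
  have ha : a ≠ 0 := left_ne_zero_of_mul h.mul_pos.ne'
  have hb : b ≠ 0 := right_ne_zero_of_mul h.mul_pos.ne'
  unfold psi
  field_simp
  ring

theorem sub_lt_psi_sub_psi (h : IsPsiGap a b) : b - a < psi b - psi a := by
  rw [h.psi_sub_psi]
  exact lt_mul_of_one_lt_right (sub_pos.2 h.lt) (lt_add_of_pos_right 1 (one_div_pos.2 h.mul_pos))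

theorem psi (h : IsPsiGap a b) : IsPsiGap (psi a) (psi b) where
  lt := sub_pos.1 ((sub_pos.2 h.lt).trans h.sub_lt_psi_sub_psi)
  notMem y hy hS := by
    have hne (x : ℝ) (hx : x ∈ Set.Icc a b) : x ≠ 0 := fun h0 =>
      h.notMem x hx (h0 ▸ zero_mem_psiBackwardOrbit)
    have hc : ContinuousOn _root_.psi (Set.Icc a b) :=
      continuousOn_id.sub (continuousOn_const.div continuousOn_id hne)
    obtain ⟨x, hx, rfl⟩ := intermediate_value_Icc h.lt.le hc hy
    exact h.notMem x hx (mem_psiBackwardOrbit_of_psi_mem (hne x hx) hS)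

theorem exists_subset_unit_of_le {M : ℝ} (hM : 0 < M) (N : ℕ) :
    ∀ {a b : ℝ}, IsPsiGap a b → 0 < a → a ≤ M → a ≤ 1 + N / M →
      ∃ c d, IsPsiGap c d ∧ 0 < c ∧ d < 1 ∧ b - a ≤ d - c := by
  have base {a b : ℝ} (h : IsPsiGap a b) (ha : 0 < a) (ha1 : a ≤ 1) :
      ∃ c d, IsPsiGap c d ∧ 0 < c ∧ d < 1 ∧ b - a ≤ d - c :=
    ⟨a, b, h, ha, not_le.1 fun hb => h.notMem 1 ⟨ha1, hb⟩ one_mem_psiBackwardOrbit, le_rfl⟩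
  induction N with
  | zero => exact fun h ha _ ha1 => base h ha (by simpa using ha1)
  | succ N ih =>
    intro a b h ha haM haN
    rcases le_or_gt a 1 with ha1 | ha1
    · exact base h ha ha1
    have hlt : 1 / a < 1 := (div_lt_one ha).2 ha1
    have hle : 1 / M ≤ 1 / a := one_div_le_one_div_of_le ha haM
    have hpos : 0 < 1 / M := one_div_pos.2 hM
    have hpsi : _root_.psi a = a - 1 / a := rfl
    push_cast at haN
    rw [add_div] at haN
    obtain ⟨c, d, hcd, hc, hd, hl⟩ :=
      ih h.psi (by linarith) (by linarith) (by linarith)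
    exact ⟨c, d, hcd, hc, hd, h.sub_lt_psi_sub_psi.le.trans hl⟩

theorem exists_subset_unit (h : IsPsiGap a b) :
    ∃ c d, IsPsiGap c d ∧ 0 < c ∧ d < 1 ∧ b - a ≤ d - c := by
  have key {a b : ℝ} (h : IsPsiGap a b) (ha : 0 < a) :
      ∃ c d, IsPsiGap c d ∧ 0 < c ∧ d < 1 ∧ b - a ≤ d - c := by
    obtain ⟨N, hN⟩ := exists_nat_ge (a * a)
    have : a ≤ N / a := (le_div_iff₀ ha).2 hN
    exact exists_subset_unit_of_le ha N h ha le_rfl (by linarith)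
  rcases h.pos_or_neg with h0 | h0
  · exact key h h0
  · obtain ⟨c, d, hcd, hc, hd, hl⟩ := key h.neg (neg_pos.2 h0)
    exact ⟨c, d, hcd, hc, hd, by linarith⟩

theorem two_pow_mul_lt_one (n : ℕ) : ∀ {a b : ℝ}, IsPsiGap a b → 2 ^ n * (b - a) < 1 := by
  induction n with
  | zero =>
    intro a b h
    obtain ⟨c, d, -, hc, hd, hl⟩ := h.exists_subset_unit
    linarith
  | succ n ih =>
    intro a b h
    obtain ⟨c, d, hcd, hc, hd, hl⟩ := h.exists_subset_unit
    have hmul : c * d < 1 :=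
      mul_lt_one_of_nonneg_of_lt_one_left hc.le (hcd.lt.trans hd) hd.le
    have hinv : 1 < 1 / (c * d) := (one_lt_div hcd.mul_pos).2 hmul
    have hdouble : 2 * (b - a) ≤ _root_.psi d - _root_.psi c := by
      rw [hcd.psi_sub_psi]
      nlinarith [hcd.lt]
    calc 2 ^ (n + 1) * (b - a) = 2 ^ n * (2 * (b - a)) := by ring
      _ ≤ 2 ^ n * (_root_.psi d - _root_.psi c) := by gcongr
      _ < 1 := ih hcd.psi

end IsPsiGap

theorem not_isPsiGap (a b : ℝ) : ¬ IsPsiGap a b := fun h => by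
  obtain ⟨n, hn⟩ := pow_unbounded_of_one_lt (1 / (b - a)) one_lt_two
  rw [div_lt_iff₀ (sub_pos.2 h.lt)] at hn
  exact hn.not_gt (IsPsiGap.two_pow_mul_lt_one n h)

theorem stmt_18 :
    Dense {x : ℝ | ∃ n : ℕ, (∀ k < n, psi^[k] x ≠ 0) ∧ psi^[n] x = 0} := by
  refine dense_of_exists_between fun a b hab => ?_
  by_contra! hgap
  refine not_isPsiGap ((2 * a + b) / 3) ((a + 2 * b) / 3) ⟨by linarith, fun x hx hS => ?_⟩
  exact hgap x hS ⟨by linarith [hx.1], by linarith [hx.2]⟩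
end

section
/- Let ν be a nonzero positive finite measure on [0,1], let a_n = ∫₀¹ tⁿ dν(t), and let α > 0. Then the sequence ((a_0 + a_1 + ⋯ + a_n)^{−α})_{n≥0} is a Hausdorff moment sequence: there exists a positive finite measure τ on [0,1] with ∫₀¹ tⁿ dτ(t) = (a_0 + a_1 + ⋯ + a_n)^{−α} for all n ≥ 0. In particular, for every α > 0 the sequence (m_n^α)_{n≥0} is a Hausdorff moment sequence. -/
open MeasureTheory Set

/-- The fixed point sequence. -/
noncomputable def fpSeq : ℕ → ℝ
  | 0 => 1
  | n + 1 => (-1 + Real.sqrt (1 + 4 * fpSeq n ^ 2)) / (2 * fpSeq n)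

open Filter Topology

/-- The backward difference `a n - a (n + 1)`. -/
def backDiff (a : ℕ → ℝ) (n : ℕ) : ℝ := a n - a (n + 1)

/-- Complete monotonicity on the window `{0, …, M}`: all iterated backward differences which only
involve the entries `a 0, …, a M` are nonnegative. -/
def CMUpTo : ℕ → (ℕ → ℝ) → Prop
  | 0, a => 0 ≤ a 0
  | M + 1, a => (∀ n ≤ M + 1, 0 ≤ a n) ∧ CMUpTo M (backDiff a)

namespace CMUpTo

lemma nonneg {M : ℕ} {a : ℕ → ℝ} (h : CMUpTo M a) {n : ℕ} (hn : n ≤ M) : 0 ≤ a n := by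
  cases M with
  | zero => obtain rfl : n = 0 := by omega
            exact h
  | succ M => exact h.1 n hn

lemma congr {M : ℕ} {a b : ℕ → ℝ} (h : CMUpTo M a) (hab : ∀ n ≤ M, a n = b n) : CMUpTo M b := by
  induction M generalizing a b with
  | zero => simpa [CMUpTo, ← hab 0 le_rfl] using h
  | succ M ih =>
    refine ⟨fun n hn ↦ hab n hn ▸ h.1 n hn, ih h.2 fun n hn ↦ ?_⟩
    simp only [backDiff, hab n (by omega), hab (n + 1) (by omega)]

lemma of_succ {M : ℕ} {a : ℕ → ℝ} (h : CMUpTo (M + 1) a) : CMUpTo M a := by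
  induction M generalizing a with
  | zero => exact h.1 0 (by omega)
  | succ M ih => exact ⟨fun n hn ↦ h.1 n (by omega), ih h.2⟩

lemma shift {M : ℕ} {a : ℕ → ℝ} (h : CMUpTo (M + 1) a) : CMUpTo M (fun n ↦ a (n + 1)) := by
  induction M generalizing a with
  | zero => exact h.1 1 (by omega)
  | succ M ih => exact ⟨fun n hn ↦ h.1 (n + 1) (by omega), ih h.2⟩

lemma const (M : ℕ) {c : ℝ} (hc : 0 ≤ c) : CMUpTo M (fun _ ↦ c) := by
  induction M generalizing c with
  | zero => exact hc
  | succ M ih => exact ⟨fun _ _ ↦ hc, (ih le_rfl).congr fun n _ ↦ by simp [backDiff]⟩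

lemma add {M : ℕ} {a b : ℕ → ℝ} (ha : CMUpTo M a) (hb : CMUpTo M b) :
    CMUpTo M (fun n ↦ a n + b n) := by
  induction M generalizing a b with
  | zero => exact add_nonneg ha hb
  | succ M ih =>
    refine ⟨fun n hn ↦ add_nonneg (ha.1 n hn) (hb.1 n hn), (ih ha.2 hb.2).congr fun n _ ↦ ?_⟩
    simp only [backDiff]; ring

lemma mul {M : ℕ} {a b : ℕ → ℝ} (ha : CMUpTo M a) (hb : CMUpTo M b) :
    CMUpTo M (fun n ↦ a n * b n) := by
  induction M generalizing a b with
  | zero => exact mul_nonneg ha hb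
  | succ M ih =>
    refine ⟨fun n hn ↦ mul_nonneg (ha.1 n hn) (hb.1 n hn),
      ((ih ha.2 hb.of_succ).add (ih ha.shift hb.2)).congr fun n _ ↦ ?_⟩
    simp only [backDiff]; ring

lemma pow {M : ℕ} {a : ℕ → ℝ} (ha : CMUpTo M a) (k : ℕ) : CMUpTo M (fun n ↦ a n ^ k) := by
  induction k with
  | zero => simpa using const M zero_le_one
  | succ k ih => simpa only [pow_succ] using ih.mul ha

lemma sum {ι : Type*} (s : Finset ι) {M : ℕ} {a : ι → ℕ → ℝ} (ha : ∀ i ∈ s, CMUpTo M (a i)) :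
    CMUpTo M (fun n ↦ ∑ i ∈ s, a i n) := by
  classical
  induction s using Finset.induction_on with
  | empty => simpa using const M le_rfl
  | insert i s hi ih =>
    simp only [Finset.sum_insert hi]
    exact (ha i (by simp)).add (ih fun j hj ↦ ha j (by simp [hj]))

lemma of_tendsto {ι : Type*} {l : Filter ι} [l.NeBot] {M : ℕ} {x : ι → ℕ → ℝ} {a : ℕ → ℝ}
    (hx : ∀ i, CMUpTo M (x i)) (h : ∀ n ≤ M, Tendsto (fun i ↦ x i n) l (𝓝 (a n))) :
    CMUpTo M a := by
  induction M generalizing x a with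
  | zero => exact ge_of_tendsto' (h 0 le_rfl) hx
  | succ M ih =>
    exact ⟨fun n hn ↦ ge_of_tendsto' (h n hn) fun i ↦ (hx i).1 n hn,
      ih (fun i ↦ (hx i).2) fun n hn ↦ (h n (by omega)).sub (h (n + 1) (by omega))⟩

lemma iterate_backDiff_nonneg {k j : ℕ} {a : ℕ → ℝ} (h : CMUpTo (k + j) a) :
    0 ≤ backDiff^[j] a k := by
  induction j generalizing a with
  | zero => exact h.nonneg le_rfl
  | succ j ih => exact ih h.2

/-- A power series with nonnegative coefficients preserves complete monotonicity. -/
lemma one_sub_rpow_neg {M : ℕ} {u : ℕ → ℝ} (hu : CMUpTo M u) (hu1 : ∀ n ≤ M, u n < 1) {α : ℝ}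
    (hα : 0 < α) : CMUpTo M (fun n ↦ (1 - u n) ^ (-α)) := by
  have hc (k : ℕ) : 0 ≤ Ring.choose (α + k - 1) k := by
    have h := Ring.factorial_nsmul_multichoose_eq_ascPochhammer α k
    rw [Polynomial.ascPochhammer_smeval_eq_eval, nsmul_eq_mul] at h
    have hpos := ascPochhammer_pos k α hα
    rw [Ring.choose, show α + k - 1 - k + 1 = α by ring]
    exact nonneg_of_mul_nonneg_right (h ▸ hpos.le) (by positivity)
  refine of_tendsto (l := atTop)
    (x := fun N n ↦ ∑ k ∈ Finset.range N, Ring.choose (α + k - 1) k * u n ^ k)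
    (fun N ↦ sum _ fun k _ ↦ (const M (hc k)).mul (hu.pow k)) fun n hn ↦ ?_
  have hmem : u n ∈ Metric.eball (0 : ℝ) 1 := by
    rw [← ENNReal.ofReal_one, Metric.eball_ofReal]
    simpa [abs_of_nonneg (hu.nonneg hn)] using hu1 n hn
  have := (Real.one_div_one_sub_rpow_hasFPowerSeriesOnBall_zero α).hasSum hmem
  simp only [FormalMultilinearSeries.ofScalars_apply_eq, zero_add, smul_eq_mul, one_div] at this
  rw [Real.rpow_neg (by linarith [hu1 n hn])]
  exact this.tendsto_sum_nat

/-- Negative powers of the partial sums of a completely monotone sequence are completely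
monotone. -/
lemma sum_range_rpow_neg {a : ℕ → ℝ} (ha : ∀ M, CMUpTo M a) (ha0 : 0 < a 0) {α : ℝ} (hα : 0 < α)
    (M : ℕ) : CMUpTo M (fun n ↦ (∑ j ∈ Finset.range (n + 1), a j) ^ (-α)) := by
  set S : ℕ → ℝ := fun n ↦ ∑ j ∈ Finset.range (n + 1), a j with hS
  have hnn (n : ℕ) : 0 ≤ a n := (ha n).nonneg le_rfl
  have hmono : Monotone S := monotone_nat_of_le_succ fun n ↦ by
    simp only [hS, Finset.sum_range_succ _ (n + 1)]; linarith [hnn (n + 1)]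
  have hpos (n : ℕ) : 0 < S n := lt_of_lt_of_le (by simpa [hS] using ha0) (hmono (Nat.zero_le n))
  have hle (n : ℕ) (hn : n ≤ M) : 0 ≤ 1 - S n / S M :=
    sub_nonneg.2 ((div_le_one (hpos M)).2 (hmono hn))
  have hu : CMUpTo M (fun n ↦ 1 - S n / S M) := by
    generalize hC : S M = C at hle
    have hCpos : 0 < C := hC ▸ hpos M
    cases M with
    | zero => exact hle 0 le_rfl
    | succ M =>
      refine ⟨hle, ((const M (inv_pos.2 hCpos).le).mul (ha (M + 1)).shift).congr fun n _ ↦ ?_⟩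
      simp only [backDiff, hS, Finset.sum_range_succ _ (n + 1)]
      ring
  have h := (const M (Real.rpow_nonneg (hpos M).le (-α))).mul
    (hu.one_sub_rpow_neg (fun n _ ↦ by have := div_pos (hpos n) (hpos M); linarith) hα)
  refine h.congr fun n _ ↦ ?_
  rw [sub_sub_cancel, ← Real.mul_rpow (hpos M).le (div_pos (hpos n) (hpos M)).le,
    mul_div_cancel₀ _ (hpos M).ne']

end CMUpTo

lemma integrableOn_Icc_of_continuous {ν : Measure ℝ} [IsFiniteMeasure ν] {g : ℝ → ℝ}
    (hg : Continuous g) : IntegrableOn g (Icc 0 1) ν :=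
  hg.continuousOn.integrableOn_compact isCompact_Icc

lemma CMUpTo.of_moments {ν : Measure ℝ} [IsFiniteMeasure ν] (M : ℕ) {g : ℝ → ℝ}
    (hg : Continuous g) (hg0 : ∀ t ∈ Icc (0 : ℝ) 1, 0 ≤ g t) :
    CMUpTo M (fun n ↦ ∫ t in Icc (0 : ℝ) 1, t ^ n * g t ∂ν) := by
  have hnn (n : ℕ) : 0 ≤ ∫ t in Icc (0 : ℝ) 1, t ^ n * g t ∂ν :=
    setIntegral_nonneg measurableSet_Icc fun t ht ↦ mul_nonneg (pow_nonneg ht.1 n) (hg0 t ht)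
  induction M generalizing g with
  | zero => exact hnn 0
  | succ M ih =>
    refine ⟨fun n _ ↦ hnn n, ?_⟩
    have hg1 (t : ℝ) (ht : t ∈ Icc (0 : ℝ) 1) : 0 ≤ (1 - t) * g t :=
      mul_nonneg (sub_nonneg.2 ht.2) (hg0 t ht)
    refine (ih (g := fun t ↦ (1 - t) * g t) (by fun_prop) hg1 fun n ↦
      setIntegral_nonneg measurableSet_Icc fun t ht ↦
        mul_nonneg (pow_nonneg ht.1 n) (hg1 t ht)).congr fun n _ ↦ ?_
    rw [backDiff, ← integral_sub (integrableOn_Icc_of_continuous (by fun_prop))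
      (integrableOn_Icc_of_continuous (by fun_prop))]
    congr 1 with t
    ring

section Hausdorff

open Polynomial

/-- The linear functional on polynomials sending `X ^ n` to `a n`. -/
noncomputable def momentFunctional (a : ℕ → ℝ) : ℝ[X] →ₗ[ℝ] ℝ :=
  Polynomial.lsum fun n ↦ a n • LinearMap.id

lemma momentFunctional_X_pow (a : ℕ → ℝ) (n : ℕ) : momentFunctional a (X ^ n) = a n := by
  simp [momentFunctional, Polynomial.lsum_apply, ← Polynomial.monomial_one_right_eq_X_pow]

lemma momentFunctional_mul_one_sub (a : ℕ → ℝ) (p : ℝ[X]) :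
    momentFunctional a (p * (1 - X)) = momentFunctional (backDiff a) p := by
  induction p using Polynomial.induction_on' with
  | add p q hp hq => simp only [add_mul, map_add, hp, hq]
  | monomial n c =>
    rw [← Polynomial.C_mul_X_pow_eq_monomial, ← Polynomial.smul_eq_C_mul, smul_mul_assoc, map_smul,
      map_smul, mul_sub, mul_one, ← pow_succ, map_sub]
    simp only [momentFunctional_X_pow, backDiff]

lemma momentFunctional_X_pow_mul (a : ℕ → ℝ) (k j : ℕ) :
    momentFunctional a (X ^ k * (1 - X) ^ j) = backDiff^[j] a k := by
  induction j generalizing a with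
  | zero => simp [momentFunctional_X_pow]
  | succ j ih => rw [pow_succ, ← mul_assoc, momentFunctional_mul_one_sub, ih]; rfl

/-- The mass at `k / N` of the `N`-th discrete approximation to the representing measure. -/
noncomputable def bernsteinWeight (a : ℕ → ℝ) (N k : ℕ) : ℝ :=
  N.choose k * backDiff^[N - k] a k

lemma bernsteinWeight_nonneg {a : ℕ → ℝ} (ha : ∀ M, CMUpTo M a) (N k : ℕ) :
    0 ≤ bernsteinWeight a N k :=
  mul_nonneg (Nat.cast_nonneg _) (ha _).iterate_backDiff_nonneg

lemma sum_bernsteinWeight_mul_choose (a : ℕ → ℝ) {m N : ℕ} (hm : m ≤ N) :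
    ∑ k ∈ Finset.range (N + 1), bernsteinWeight a N k * (k.choose m / N.choose m) = a m := by
  obtain ⟨d, rfl⟩ := Nat.exists_eq_add_of_le hm
  have hX : (X : ℝ[X]) ^ m = ∑ j ∈ Finset.range (d + 1),
      (d.choose j : ℝ) • (X ^ (m + j) * (1 - X) ^ (d - j)) := by
    have h := add_pow (X : ℝ[X]) (1 - X) d
    rw [add_sub_cancel, one_pow] at h
    conv_lhs => rw [← mul_one (X ^ m), h, Finset.mul_sum]
    refine Finset.sum_congr rfl fun j _ ↦ ?_
    rw [Polynomial.smul_eq_C_mul, Polynomial.C_eq_natCast, pow_add]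
    ring
  have hC : ((m + d).choose m : ℝ) ≠ 0 := by
    exact_mod_cast (Nat.choose_pos (Nat.le_add_right m d)).ne'
  have ha := congrArg (momentFunctional a) hX
  simp only [map_sum, map_smul, momentFunctional_X_pow, momentFunctional_X_pow_mul,
    smul_eq_mul] at ha
  rw [ha, add_assoc, Finset.sum_range_add, Finset.sum_eq_zero, zero_add]
  · refine Finset.sum_congr rfl fun j _ ↦ ?_
    have h := Nat.choose_mul (n := m + d) (Nat.le_add_right m j)
    rw [Nat.add_sub_cancel_left, Nat.add_sub_cancel_left] at h
    have h' : ((m + d).choose (m + j) : ℝ) * (m + j).choose m = (m + d).choose m * d.choose j := by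
      exact_mod_cast h
    rw [bernsteinWeight, Nat.add_sub_add_left]
    field_simp
    linear_combination (backDiff^[d - j] a (m + j)) * h'
  · intro k hk
    rw [Nat.choose_eq_zero_of_lt (Finset.mem_range.1 hk)]
    simp

lemma abs_choose_div_choose_sub_pow_le {m N k : ℕ} (hm : m < N) (hk : k ≤ N) :
    |(k.choose m / N.choose m : ℝ) - (k / N : ℝ) ^ m| ≤ m * (m / (N - m)) := by
  have hN : (0 : ℝ) < N := by exact_mod_cast (by omega : 0 < N)
  induction m with
  | zero => simp
  | succ m ih =>
    have hNm : (0 : ℝ) < N - m - 1 := by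
      have : ((m + 1 : ℕ) : ℝ) < N := by exact_mod_cast hm
      push_cast at this; linarith
    have hkN : (k : ℝ) ≤ N := by exact_mod_cast hk
    have hm0 : (0 : ℝ) ≤ m := Nat.cast_nonneg m
    have hk0 : (0 : ℝ) ≤ k := Nat.cast_nonneg k
    specialize ih (by omega)
    set y : ℝ := ((k - m : ℕ) : ℝ) / (N - m) with hy
    have hrec : (k.choose (m + 1) / N.choose (m + 1) : ℝ) = k.choose m / N.choose m * y := by
      have h1 : (k.choose (m + 1) : ℝ) * (m + 1) = k.choose m * ((k - m : ℕ) : ℝ) := by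
        exact_mod_cast Nat.choose_succ_right_eq k m
      have h2 : (N.choose (m + 1) : ℝ) * (m + 1) = N.choose m * (N - m) := by
        rw [← Nat.cast_sub (by omega)]
        exact_mod_cast Nat.choose_succ_right_eq N m
      rw [hy, div_mul_div_comm, ← h1, ← h2, mul_div_mul_right _ _ (by positivity)]
    have hy0 : 0 ≤ y := div_nonneg (Nat.cast_nonneg _) (by linarith)
    have hy1 : y ≤ 1 := by
      rw [hy, div_le_one (by linarith), ← Nat.cast_sub (by omega)]
      exact_mod_cast Nat.sub_le_sub_right hk m
    have hz0 : (0 : ℝ) ≤ k / N := by positivity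
    have hz1 : (k : ℝ) / N ≤ 1 := (div_le_one hN).2 hkN
    have hyz : |y - k / N| ≤ m / (N - m) := by
      have hNm' : (0 : ℝ) < N - m := by linarith
      rcases le_total m k with hmk | hmk
      · rw [hy, Nat.cast_sub hmk, abs_sub_comm, abs_of_nonneg]
        · rw [div_sub_div _ _ hN.ne' hNm'.ne', div_le_div_iff₀ (by positivity) hNm']
          have : 0 ≤ m * k * ((N : ℝ) - m) := by positivity
          nlinarith
        · rw [sub_nonneg, div_le_div_iff₀ hNm' hN]
          nlinarith
      · have hkm : (k : ℝ) ≤ m := by exact_mod_cast hmk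
        rw [hy, Nat.sub_eq_zero_of_le hmk, Nat.cast_zero, zero_div, zero_sub, abs_neg,
          abs_of_nonneg hz0]
        gcongr
        linarith
    have hz : |((k : ℝ) / N) ^ m| ≤ 1 := by
      rw [abs_of_nonneg (by positivity)]; exact pow_le_one₀ hz0 hz1
    calc |(k.choose (m + 1) / N.choose (m + 1) : ℝ) - (k / N : ℝ) ^ (m + 1)|
        = |(k.choose m / N.choose m - (k / N : ℝ) ^ m) * y + (k / N : ℝ) ^ m * (y - k / N)| := by
          rw [hrec]; ring_nf
      _ ≤ |(k.choose m / N.choose m - (k / N : ℝ) ^ m)| * 1 + 1 * |y - k / N| := by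
          refine (abs_add_le _ _).trans ?_
          rw [abs_mul, abs_mul, abs_of_nonneg hy0]
          gcongr
      _ ≤ m * (m / (N - m)) + m / (N - m) := by linarith
      _ = (m + 1) * (m / (N - m)) := by ring
      _ ≤ ((m + 1 : ℕ) : ℝ) * ((m + 1 : ℕ) / (N - (m + 1 : ℕ))) := by
          push_cast
          gcongr <;> linarith

lemma tendsto_sum_bernsteinWeight {a : ℕ → ℝ} (ha : ∀ M, CMUpTo M a) (m : ℕ) :
    Tendsto (fun N : ℕ ↦ ∑ k ∈ Finset.range (N + 1), bernsteinWeight a N k * (k / N : ℝ) ^ m)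
      atTop (𝓝 (a m)) := by
  have hlim : Tendsto (fun N : ℕ ↦ a 0 * (m * (m / ((N : ℝ) - m)))) atTop (𝓝 0) := by
    have h : Tendsto (fun N : ℕ ↦ (N : ℝ) - m) atTop atTop :=
      tendsto_atTop_add_const_right _ _ tendsto_natCast_atTop_atTop
    simpa using ((h.const_div_atTop (m : ℝ)).const_mul (m : ℝ)).const_mul (a 0)
  rw [tendsto_iff_dist_tendsto_zero]
  refine squeeze_zero' (Eventually.of_forall fun _ ↦ dist_nonneg) ?_ hlim
  filter_upwards [eventually_gt_atTop m] with N hN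
  have h0 := sum_bernsteinWeight_mul_choose a (Nat.zero_le N)
  simp only [Nat.choose_zero_right, Nat.cast_one, div_one, mul_one] at h0
  rw [dist_comm, Real.dist_eq, ← sum_bernsteinWeight_mul_choose a hN.le, ← Finset.sum_sub_distrib,
    ← h0, Finset.sum_mul]
  refine (Finset.abs_sum_le_sum_abs _ _).trans (Finset.sum_le_sum fun k hk ↦ ?_)
  rw [← mul_sub, abs_mul, abs_of_nonneg (bernsteinWeight_nonneg ha N k)]
  exact mul_le_mul_of_nonneg_left
    (abs_choose_div_choose_sub_pow_le hN (Nat.lt_succ_iff.1 (Finset.mem_range.1 hk)))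
    (bernsteinWeight_nonneg ha N k)

end Hausdorff

/-- Finite measures on `[0, 1]` with bounded masses and convergent moments: the limits of the
moments are again the moments of a finite measure on `[0, 1]`. -/
lemma exists_measure_of_tendsto_moments {a : ℕ → ℝ} (μ : ℕ → FiniteMeasure ℝ) (C : NNReal)
    (hC : ∀ N, (μ N).mass ≤ C) (hsupp : ∀ N, μ N (Icc (0 : ℝ) 1)ᶜ = 0)
    (hlim : ∀ m : ℕ, Tendsto (fun N ↦ ∫ t in Icc (0 : ℝ) 1, t ^ m ∂(μ N : Measure ℝ)) atTop
      (𝓝 (a m))) :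
    ∃ τ : Measure ℝ, IsFiniteMeasure τ ∧ τ (Icc (0 : ℝ) 1)ᶜ = 0 ∧
      ∀ m : ℕ, ∫ t in Icc (0 : ℝ) 1, t ^ m ∂τ = a m := by
  have hcpt := isCompact_setOfPred_finiteMeasure_le_of_isCompact (E := ℝ) C
    (isCompact_Icc (a := (0 : ℝ)) (b := 1))
  obtain ⟨τ, ⟨-, hτ⟩, hle⟩ := hcpt.ultrafilter_le_nhds' ((hyperfilter ℕ).map μ)
    (Ultrafilter.mem_map.2 (univ_mem' fun N ↦ ⟨hC N, hsupp N⟩))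
  have hnull {σ : FiniteMeasure ℝ} (h : σ (Icc (0 : ℝ) 1)ᶜ = 0) :
      (σ : Measure ℝ) (Icc (0 : ℝ) 1)ᶜ = 0 := by
    rw [← FiniteMeasure.ennreal_coeFn_eq_coeFn_toMeasure, h, ENNReal.coe_zero]
  refine ⟨τ, inferInstance, hnull hτ, fun m ↦ ?_⟩
  let f : BoundedContinuousFunction ℝ ℝ := BoundedContinuousFunction.ofNormedAddCommGroup
    (fun t ↦ (projIcc (0 : ℝ) 1 zero_le_one t : ℝ) ^ m) (by fun_prop) 1 fun t ↦ by
      have h := (projIcc (0 : ℝ) 1 zero_le_one t).2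
      rw [Real.norm_of_nonneg (pow_nonneg h.1 m)]
      exact pow_le_one₀ h.1 h.2
  have hf {σ : FiniteMeasure ℝ} (h : σ (Icc (0 : ℝ) 1)ᶜ = 0) :
      ∫ t, f t ∂(σ : Measure ℝ) = ∫ t in Icc (0 : ℝ) 1, t ^ m ∂(σ : Measure ℝ) := by
    rw [← Measure.restrict_eq_self_of_ae_mem (s := Icc (0 : ℝ) 1) (hnull h),
      Measure.restrict_restrict measurableSet_Icc, inter_self]
    refine setIntegral_congr_fun measurableSet_Icc fun t ht ↦ ?_
    simp [f, projIcc_of_mem zero_le_one ht]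
  have h1 : Tendsto μ (hyperfilter ℕ) (𝓝 τ) := hle
  have h2 := FiniteMeasure.tendsto_iff_forall_integral_tendsto.1 h1 f
  simp only [hf hτ, hf (hsupp _)] at h2
  exact tendsto_nhds_unique h2 ((hlim m).mono_left Nat.hyperfilter_le_atTop)

/-- **Hausdorff's theorem**: a completely monotone sequence is a moment sequence on `[0, 1]`. -/
lemma exists_measure_of_completelyMonotone {a : ℕ → ℝ} (ha : ∀ M, CMUpTo M a) :
    ∃ τ : Measure ℝ, IsFiniteMeasure τ ∧ τ (Icc (0 : ℝ) 1)ᶜ = 0 ∧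
      ∀ m : ℕ, ∫ t in Icc (0 : ℝ) 1, t ^ m ∂τ = a m := by
  let ρ (N : ℕ) : Measure ℝ := ∑ k ∈ Finset.range (N + 1),
    ENNReal.ofReal (bernsteinWeight a N k) • Measure.dirac (k / N : ℝ)
  have hmem {N k : ℕ} (hk : k ∈ Finset.range (N + 1)) : (k / N : ℝ) ∈ Icc (0 : ℝ) 1 :=
    ⟨by positivity, div_le_one_of_le₀
      (by exact_mod_cast Nat.lt_succ_iff.1 (Finset.mem_range.1 hk)) (Nat.cast_nonneg N)⟩
  have hmass (N : ℕ) : ρ N univ = ENNReal.ofReal (a 0) := by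
    have h0 := sum_bernsteinWeight_mul_choose a (Nat.zero_le N)
    simp only [Nat.choose_zero_right, Nat.cast_one, div_one, mul_one] at h0
    simp [ρ, ← h0, ENNReal.ofReal_sum_of_nonneg fun k _ ↦ bernsteinWeight_nonneg ha N k]
  have hfin (N : ℕ) : IsFiniteMeasure (ρ N) := ⟨by simp [hmass]⟩
  have hsupp (N : ℕ) : ρ N (Icc (0 : ℝ) 1)ᶜ = 0 := by
    simp only [ρ, Measure.finsetSum_apply, Measure.smul_apply]
    refine Finset.sum_eq_zero fun k hk ↦ ?_
    simp [Measure.dirac_apply' _ measurableSet_Icc.compl, -mem_Icc, hmem hk]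
  let μ (N : ℕ) : FiniteMeasure ℝ := ⟨ρ N, hfin N⟩
  refine exists_measure_of_tendsto_moments μ (a 0).toNNReal ?_ ?_ fun m ↦ ?_
  · intro N
    rw [← ENNReal.coe_le_coe, FiniteMeasure.ennreal_mass]
    exact (hmass N).le
  · intro N
    rw [FiniteMeasure.null_iff_toMeasure_null]
    exact hsupp N
  · refine (tendsto_sum_bernsteinWeight ha m).congr fun N ↦ ?_
    have hae : ∀ᵐ t ∂ρ N, t ∈ Icc (0 : ℝ) 1 := hsupp N
    change _ = ∫ t in Icc (0 : ℝ) 1, t ^ m ∂ρ N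
    rw [Measure.restrict_eq_self_of_ae_mem hae, integral_finsetSum_measure]
    · refine Finset.sum_congr rfl fun k _ ↦ ?_
      rw [integral_smul_measure, integral_dirac,
        ENNReal.toReal_ofReal (bernsteinWeight_nonneg ha N k), smul_eq_mul]
    · intro k _
      exact (integrable_dirac (by simp)).smul_measure ENNReal.ofReal_ne_top

lemma fpSeq_pos (n : ℕ) : 0 < fpSeq n := by
  induction n with
  | zero => simp [fpSeq]
  | succ n ih =>
    rw [fpSeq]
    refine div_pos ?_ (by positivity)
    have : 1 < Real.sqrt (1 + 4 * fpSeq n ^ 2) := Real.lt_sqrt_of_sq_lt (by nlinarith)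
    linarith

lemma fpSeq_mul_sum (n : ℕ) : fpSeq n * ∑ j ∈ Finset.range (n + 1), fpSeq j = 1 := by
  induction n with
  | zero => simp [fpSeq]
  | succ n ih =>
    have hpos := fpSeq_pos n
    have hquad : fpSeq n * fpSeq (n + 1) ^ 2 + fpSeq (n + 1) = fpSeq n := by
      have hs := Real.sq_sqrt (show 0 ≤ 1 + 4 * fpSeq n ^ 2 by positivity)
      rw [fpSeq]
      set r := Real.sqrt (1 + 4 * fpSeq n ^ 2)
      field_simp
      linear_combination hs
    rw [Finset.sum_range_succ]
    refine mul_left_cancel₀ hpos.ne' ?_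
    linear_combination fpSeq (n + 1) * ih + hquad

lemma fpSeq_eq_inv_sum (n : ℕ) : fpSeq n = (∑ j ∈ Finset.range (n + 1), fpSeq j)⁻¹ :=
  eq_inv_of_mul_eq_one_left (fpSeq_mul_sum n)

/-- A perturbed contraction inequality with vanishing perturbation forces convergence to zero. -/
lemma tendsto_zero_of_le_mul_add {e d : ℕ → ℝ} {c : ℝ} (hc0 : 0 ≤ c) (hc1 : c < 1)
    (he : ∀ k, 0 ≤ e k) (hd : Tendsto d atTop (𝓝 0)) (h : ∀ k, e (k + 1) ≤ c * (e k + d k)) :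
    Tendsto e atTop (𝓝 0) := by
  refine (tendsto_order.2 ⟨fun b hb ↦ Eventually.of_forall fun k ↦ hb.trans_le (he k),
    fun ε hε ↦ ?_⟩)
  have hcd : Tendsto (fun k ↦ c * d k) atTop (𝓝 0) := by simpa using hd.const_mul c
  obtain ⟨K, hK⟩ := eventually_atTop.1
    (hcd.eventually_lt_const (show 0 < (1 - c) * (ε / 2) by
      exact mul_pos (by linarith) (by linarith)))
  have hstep (j : ℕ) : e (j + K) - ε / 2 ≤ c ^ j * (e K - ε / 2) := by
    induction j with
    | zero => simp
    | succ j ih =>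
      have h1 := h (j + K)
      have h2 := hK (j + K) (by omega)
      have h3 := mul_le_mul_of_nonneg_left ih hc0
      rw [show j + 1 + K = j + K + 1 by ring, pow_succ']
      linarith
  have hgeo : Tendsto (fun j : ℕ ↦ c ^ j * (e K - ε / 2)) atTop (𝓝 0) := by
    simpa using (tendsto_pow_atTop_nhds_zero_of_lt_one hc0 hc1).mul_const (e K - ε / 2)
  have hev := hgeo.eventually_lt_const (half_pos hε)
  rw [← map_add_atTop_eq_nat K, eventually_map]
  filter_upwards [hev] with j hj
  linarith [hstep j]

/-- Iterates of `a ↦ (1 / (a 0 + ⋯ + a n))ₙ` starting from the constant sequence `1`. -/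
noncomputable def fpIter : ℕ → ℕ → ℝ
  | 0 => fun _ ↦ 1
  | k + 1 => fun n ↦ (∑ j ∈ Finset.range (n + 1), fpIter k j) ^ (-1 : ℝ)

lemma fpIter_zero_right (k : ℕ) : fpIter k 0 = 1 := by
  induction k with
  | zero => rfl
  | succ k ih => simp [fpIter, ih]

lemma fpIter_cmUpTo (k M : ℕ) : CMUpTo M (fpIter k) := by
  induction k generalizing M with
  | zero => exact CMUpTo.const M zero_le_one
  | succ k ih =>
    exact CMUpTo.sum_range_rpow_neg ih (by simp [fpIter_zero_right]) one_pos M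

lemma tendsto_fpIter (n : ℕ) : Tendsto (fun k ↦ fpIter k n) atTop (𝓝 (fpSeq n)) := by
  induction n using Nat.strong_induction_on with
  | _ n ih =>
    cases n with
    | zero => simp [fpIter_zero_right, fpSeq]
    | succ n =>
      have hnn (k j : ℕ) : 0 ≤ fpIter k j := (fpIter_cmUpTo k j).nonneg le_rfl
      set σ : ℝ := ∑ j ∈ Finset.range (n + 1), fpSeq j
      let s (k : ℕ) : ℝ := ∑ j ∈ Finset.range (n + 1), fpIter k j
      have hs1 (k : ℕ) : 1 ≤ s k := by
        rw [← fpIter_zero_right k]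
        exact Finset.single_le_sum (f := fpIter k) (fun j _ ↦ hnn k j) (by simp)
      have hσ1 : 1 ≤ σ := by
        have := Finset.single_le_sum (f := fpSeq) (s := Finset.range (n + 1)) (a := 0)
          (fun j _ ↦ (fpSeq_pos j).le) (by simp)
        simpa [fpSeq] using this
      have hslim : Tendsto s atTop (𝓝 σ) :=
        tendsto_finsetSum _ fun j hj ↦ ih j (Finset.mem_range.1 hj)
      have hd : Tendsto (fun k ↦ |s k - σ|) atTop (𝓝 0) := by
        simpa using (hslim.sub_const σ).abs
      set m : ℝ := fpSeq (n + 1)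
      have hm0 : 0 < m := fpSeq_pos _
      have hmeq : m * (σ + m) = 1 := by
        have := fpSeq_mul_sum (n + 1)
        rwa [Finset.sum_range_succ] at this
      have hm1 : m < 1 := by nlinarith
      have key : Tendsto (fun k ↦ |fpIter k (n + 1) - m|) atTop (𝓝 0) := by
        refine tendsto_zero_of_le_mul_add hm0.le hm1 (fun k ↦ abs_nonneg _) hd fun k ↦ ?_
        have hx : fpIter (k + 1) (n + 1) = (s k + fpIter k (n + 1))⁻¹ := by
          simp only [fpIter, Real.rpow_neg_one, Finset.sum_range_succ _ (n + 1), s]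
        have hx0 := hnn k (n + 1)
        have hden : 1 ≤ s k + fpIter k (n + 1) := by linarith [hs1 k]
        have hdiff : fpIter (k + 1) (n + 1) - m =
            -(m * ((fpIter k (n + 1) - m) + (s k - σ)) * (s k + fpIter k (n + 1))⁻¹) := by
          rw [hx]
          field_simp
          linear_combination -hmeq
        rw [hdiff, abs_neg, abs_mul, abs_mul, abs_of_pos hm0,
          abs_of_pos (inv_pos.2 (by linarith : 0 < s k + fpIter k (n + 1)))]
        refine (mul_le_of_le_one_right (by positivity) (inv_le_one_of_one_le₀ hden)).trans ?_
        gcongr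
        exact abs_add_le _ _
      have := tendsto_zero_iff_abs_tendsto_zero _ |>.2 key
      simpa using this.add_const m

lemma fpSeq_cmUpTo (M : ℕ) : CMUpTo M fpSeq :=
  CMUpTo.of_tendsto (l := atTop) (fun k ↦ fpIter_cmUpTo k M) fun n _ ↦ tendsto_fpIter n

theorem stmt_19 :
    (∀ (ν : Measure ℝ), IsFiniteMeasure ν → ν ≠ 0 → ν (Set.Icc (0:ℝ) 1)ᶜ = 0 →
      ∀ (a : ℕ → ℝ), (∀ n : ℕ, a n = ∫ t in Set.Icc (0:ℝ) 1, t ^ n ∂ν) →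
      ∀ α : ℝ, 0 < α →
        ∃ τ : Measure ℝ, IsFiniteMeasure τ ∧ τ (Set.Icc (0:ℝ) 1)ᶜ = 0 ∧
          ∀ n : ℕ, ∫ t in Set.Icc (0:ℝ) 1, t ^ n ∂τ =
            (∑ j ∈ Finset.range (n + 1), a j) ^ (-α)) ∧
    ∀ α : ℝ, 0 < α →
      ∃ τ : Measure ℝ, IsFiniteMeasure τ ∧ τ (Set.Icc (0:ℝ) 1)ᶜ = 0 ∧
        ∀ n : ℕ, ∫ t in Set.Icc (0:ℝ) 1, t ^ n ∂τ = fpSeq n ^ α := by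
  constructor
  · intro ν hν hν0 hsupp a ha α hα
    have hcm (M : ℕ) : CMUpTo M a :=
      (CMUpTo.of_moments (ν := ν) M continuous_const fun _ _ ↦ zero_le_one).congr fun n _ ↦ by
        simp [ha n]
    have ha0 : 0 < a 0 := by
      have hpos : 0 < ν (Icc (0 : ℝ) 1) := by
        refine pos_iff_ne_zero.2 fun h ↦ hν0 ?_
        rw [← Measure.measure_univ_eq_zero, ← union_compl_self (Icc (0 : ℝ) 1)]
        exact measure_union_null h hsupp
      rw [ha 0]
      simpa [Measure.real] using ENNReal.toReal_pos hpos.ne' (measure_ne_top ν _)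
    exact exists_measure_of_completelyMonotone (CMUpTo.sum_range_rpow_neg hcm ha0 hα)
  · intro α hα
    have h (n : ℕ) : fpSeq n ^ α = (∑ j ∈ Finset.range (n + 1), fpSeq j) ^ (-α) := by
      have hnn : 0 ≤ ∑ j ∈ Finset.range (n + 1), fpSeq j :=
        Finset.sum_nonneg fun j _ ↦ (fpSeq_pos j).le
      rw [Real.rpow_neg hnn, ← Real.inv_rpow hnn, ← fpSeq_eq_inv_sum]
    simp only [h]
    exact exists_measure_of_completelyMonotone
      (CMUpTo.sum_range_rpow_neg fpSeq_cmUpTo (fpSeq_pos 0) hα)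
end
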